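/- arXiv:2504.13076 — 3 statements merged into one kernel-verified Lean document; each statement's English description precedes it below -/
import Mathlib

section
/- Let N ≥ 1 and r : Fin N → ℝ with 0 < r i for all i, and let T := {z : Fin N → ℂ | ∀ i, ‖z i‖ = r i} be the product (Clifford-type) torus. For every smooth map u : ℂ → (Fin N → ℂ) (ContDiff ℝ ⊤ u) with u '' Metric.sphere (0:ℂ) 1 ⊆ T, there exist integers n : Fin N → ℤ such that the symplectic area of u equals ∑ i, (n i : ℝ) * π * (r i)^2. In particular, when all r i are equal to Real.sqrt (δ/π) for some δ > 0, every smooth disk with boundary on the Clifford torus has symplectic area an integer multiple of δ, so every such disk with positive symplectic area has area at least δ. -/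
open scoped Manifold Real

noncomputable section

/-- The standard symplectic form on `ℂ^N`. -/
def stdOmega {N : ℕ} (v w : Fin N → ℂ) : ℝ :=
  ∑ i, ((v i).re * (w i).im - (v i).im * (w i).re)

/-- The symplectic area of a smooth map `u : ℂ → ℂ^N` over the closed unit disk. -/
def sympArea {N : ℕ} (u : ℂ → (Fin N → ℂ)) : ℝ :=
  ∫ z in Metric.closedBall (0:ℂ) 1,
    stdOmega (fderiv ℝ u z 1) (fderiv ℝ u z Complex.I)

/-- A smooth disk in `X` with boundary on `L`. -/
def IsSmoothDisk {N : ℕ} (X L : Set (Fin N → ℂ)) (u : ℂ → (Fin N → ℂ)) : Prop :=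
  ContDiff ℝ (⊤ : ℕ∞) u ∧ u '' Metric.closedBall (0:ℂ) 1 ⊆ X ∧ u '' Metric.sphere (0:ℂ) 1 ⊆ L

/-- The model with corners for the `N`-torus `Fin N → Circle`. -/
def torusModel (N : ℕ) :
    ModelWithCorners ℝ (Fin N → EuclideanSpace ℝ (Fin 1))
      (ModelPi fun _ : Fin N => EuclideanSpace ℝ (Fin 1)) :=
  ModelWithCorners.pi fun _ : Fin N => (𝓡 1)

/-- A Lagrangian `N`-torus contained in `X ⊆ ℂ^N`: a smooth injective immersion
`f : (Fin N → Circle) → ℂ^N` with range in `X` on which the standard symplectic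
form vanishes. -/
def IsLagrangianTorus {N : ℕ} (X : Set (Fin N → ℂ))
    (f : (Fin N → Circle) → (Fin N → ℂ)) : Prop :=
  ContMDiff (torusModel N) 𝓘(ℝ, Fin N → ℂ) (⊤ : ℕ∞) f ∧
  Function.Injective f ∧
  (∀ x, Function.Injective (mfderiv (torusModel N) 𝓘(ℝ, Fin N → ℂ) f x)) ∧
  Set.range f ⊆ X ∧
  ∀ x (v w : Fin N → EuclideanSpace ℝ (Fin 1)),
    stdOmega (mfderiv (torusModel N) 𝓘(ℝ, Fin N → ℂ) f x v)
      (mfderiv (torusModel N) 𝓘(ℝ, Fin N → ℂ) f x w) = 0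

open MeasureTheory Set

/-- **Green's formula** on a rectangle for the pullback of the area form by `(a, b)`. -/
theorem integral_jacobian_Icc_eq_boundary {a b : ℝ × ℝ → ℝ} (ha : ContDiff ℝ 2 a)
    (hb : ContDiff ℝ 2 b) {A B : ℝ × ℝ} (hAB : A ≤ B) :
    ∫ p in Icc A B, (fderiv ℝ a p (1, 0) * fderiv ℝ b p (0, 1) -
        fderiv ℝ b p (1, 0) * fderiv ℝ a p (0, 1)) =
      (((∫ x in A.1..B.1, (b (x, B.2) * fderiv ℝ a (x, B.2) (1, 0) -
            a (x, B.2) * fderiv ℝ b (x, B.2) (1, 0)) / 2) -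
          ∫ x in A.1..B.1, (b (x, A.2) * fderiv ℝ a (x, A.2) (1, 0) -
            a (x, A.2) * fderiv ℝ b (x, A.2) (1, 0)) / 2) +
        ∫ y in A.2..B.2, (a (B.1, y) * fderiv ℝ b (B.1, y) (0, 1) -
          b (B.1, y) * fderiv ℝ a (B.1, y) (0, 1)) / 2) -
        ∫ y in A.2..B.2, (a (A.1, y) * fderiv ℝ b (A.1, y) (0, 1) -
          b (A.1, y) * fderiv ℝ a (A.1, y) (0, 1)) / 2 := by
  have hfd : ∀ {c : ℝ × ℝ → ℝ}, ContDiff ℝ 2 c → ∀ v, ContDiff ℝ 1 fun p => fderiv ℝ c p v :=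
    fun hc v => (hc.fderiv_right (m := 1) (by norm_num)).clm_apply contDiff_const
  have hsymm : ∀ {c : ℝ × ℝ → ℝ}, ContDiff ℝ 2 c → ∀ p,
      fderiv ℝ (fun q => fderiv ℝ c q (0, 1)) p (1, 0) =
        fderiv ℝ (fun q => fderiv ℝ c q (1, 0)) p (0, 1) := by
    intro c hc p
    have hd : DifferentiableAt ℝ (fderiv ℝ c) p :=
      (hc.fderiv_right (m := 1) (by norm_num)).differentiable one_ne_zero p
    have h := hc.contDiffAt.isSymmSndFDerivAt (x := p) (by simp) (1, 0) (0, 1)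
    rw [fderiv_clm_apply hd (differentiableAt_const _),
      fderiv_clm_apply hd (differentiableAt_const _)]
    simpa using h
  have hF : ∀ v, ContDiff ℝ 1 fun p => (a p * fderiv ℝ b p v - b p * fderiv ℝ a p v) / 2 :=
    fun v => (((ha.of_le (by norm_num)).mul (hfd hb v)).sub
      ((hb.of_le (by norm_num)).mul (hfd ha v))).div_const 2
  have hG : ∀ v, ContDiff ℝ 1 fun p => (b p * fderiv ℝ a p v - a p * fderiv ℝ b p v) / 2 :=
    fun v => (((hb.of_le (by norm_num)).mul (hfd ha v)).sub
      ((ha.of_le (by norm_num)).mul (hfd hb v))).div_const 2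
  have hdiv : ∀ {c d : ℝ × ℝ → ℝ}, ContDiff ℝ 2 c → ContDiff ℝ 2 d → ∀ v w p,
      fderiv ℝ (fun p => (c p * fderiv ℝ d p v - d p * fderiv ℝ c p v) / 2) p w =
        (c p * fderiv ℝ (fun q => fderiv ℝ d q v) p w + fderiv ℝ d p v * fderiv ℝ c p w -
          (d p * fderiv ℝ (fun q => fderiv ℝ c q v) p w +
            fderiv ℝ c p v * fderiv ℝ d p w)) / 2 := by
    intro c d hc hd v w p
    have h1 := (hc.differentiable two_ne_zero p).hasFDerivAt
    have h2 := (hd.differentiable two_ne_zero p).hasFDerivAt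
    have h3 := ((hfd hc v).differentiable one_ne_zero p).hasFDerivAt
    have h4 := ((hfd hd v).differentiable one_ne_zero p).hasFDerivAt
    have h := (((h1.mul h4).sub (h2.mul h3)).mul_const (2⁻¹ : ℝ)).fderiv
    simp only [div_eq_mul_inv]
    rw [show (fun p => (c p * fderiv ℝ d p v - d p * fderiv ℝ c p v) * 2⁻¹) =
      fun p => ((c * fun q => fderiv ℝ d q v) - (d * fun q => fderiv ℝ c q v)) p * 2⁻¹ from rfl, h]
    simp only [smul_apply, sub_apply, add_apply, smul_eq_mul]
    ring
  have key := integral_divergence_prod_Icc_of_hasFDerivAt_of_le _ _ _ _ A B hAB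
    (hF (0, 1)).continuous.continuousOn (hG (1, 0)).continuous.continuousOn
    (fun x _ => ((hF (0, 1)).differentiable one_ne_zero x).hasFDerivAt)
    (fun x _ => ((hG (1, 0)).differentiable one_ne_zero x).hasFDerivAt)
    (((((hF (0, 1)).continuous_fderiv one_ne_zero).clm_apply continuous_const).add
      (((hG (1, 0)).continuous_fderiv one_ne_zero).clm_apply
        continuous_const)).continuousOn.integrableOn_compact isCompact_Icc)
  rw [← key]
  refine integral_congr_ae (Filter.Eventually.of_forall fun p => ?_)
  simp only [hdiv ha hb, hdiv hb ha, hsymm ha, hsymm hb]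
  ring

/-- A closed `C¹` loop on the circle of radius `R` about the origin sweeps out an integer multiple
of twice the area of the disk. -/
theorem exists_int_integral_area_form_of_norm_eq {γ γ' : ℝ → ℂ} {R s t : ℝ} (hR : 0 < R)
    (hγ : ∀ x, HasDerivAt γ (γ' x) x) (hγ' : Continuous γ') (hnorm : ∀ x, ‖γ x‖ = R)
    (hst : γ s = γ t) :
    ∃ n : ℤ, ∫ x in s..t, ((γ x).re * (γ' x).im - (γ x).im * (γ' x).re) =
      n * (2 * π * R ^ 2) := by
  have hγc : Continuous γ := continuous_iff_continuousAt.2 fun x => (hγ x).continuousAt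
  set w : ℝ → ℝ := fun x => (γ x).re * (γ' x).im - (γ x).im * (γ' x).re with hw
  have hwc : Continuous w := by fun_prop
  have hre : ∀ x, HasDerivAt (fun x => (γ x).re) (γ' x).re x := fun x =>
    Complex.reCLM.hasFDerivAt.comp_hasDerivAt x (hγ x)
  have him : ∀ x, HasDerivAt (fun x => (γ x).im) (γ' x).im x := fun x =>
    Complex.imCLM.hasFDerivAt.comp_hasDerivAt x (hγ x)
  have hsq : ∀ x, (γ x).re * (γ x).re + (γ x).im * (γ x).im = R ^ 2 := fun x => by
    rw [← hnorm x, ← Complex.normSq_apply, Complex.normSq_eq_norm_sq]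
  have horth : ∀ x, (γ x).re * (γ' x).re + (γ x).im * (γ' x).im = 0 := by
    intro x
    have h1 := ((hre x).mul (hre x)).add ((him x).mul (him x))
    have h2 := h1.unique ((hasDerivAt_const x (R ^ 2)).congr_of_eventuallyEq
      (Filter.Eventually.of_forall hsq))
    linarith
  have hR0 : (R : ℂ) ≠ 0 := by exact_mod_cast hR.ne'
  have hode : ∀ x, γ' x = γ x * ((w x : ℂ) / R ^ 2 * Complex.I) := by
    intro x
    have h1 : γ' x * R ^ 2 = γ x * (w x * Complex.I) := by
      have e1 := hsq x
      have e2 := horth x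
      apply Complex.ext
      · simp [hw, ← Complex.ofReal_pow, ← e1]
        linear_combination (γ x).re * e2
      · simp [hw, ← Complex.ofReal_pow, ← e1]
        linear_combination (γ x).im * e2
    field_simp
    linear_combination h1
  set θ : ℝ → ℂ := fun x => ((∫ y in s..x, w y : ℝ) : ℂ) / R ^ 2 * Complex.I with hθ
  have hθd : ∀ x, HasDerivAt θ ((w x : ℂ) / R ^ 2 * Complex.I) x := fun x =>
    (((hwc.integral_hasStrictDerivAt s x).hasDerivAt.ofReal_comp).div_const _).mul_const _
  have hconst : ∀ x, HasDerivAt (fun x => γ x * Complex.exp (-θ x)) 0 x := by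
    intro x
    convert! (hγ x).mul ((hθd x).neg.cexp) using 1
    rw [hode x]
    ring
  have heq := is_const_of_deriv_eq_zero (fun x => (hconst x).differentiableAt)
    (fun x => (hconst x).deriv) s t
  have hγ0 : γ t ≠ 0 := norm_pos_iff.1 (by rw [hnorm]; exact hR)
  have hexp : Complex.exp (-θ t) = 1 := by
    have hθs : θ s = 0 := by simp [hθ]
    simp only [hst, hθs, neg_zero, Complex.exp_zero] at heq
    exact (mul_left_cancel₀ hγ0 heq).symm
  obtain ⟨n, hn⟩ := Complex.exp_eq_one_iff.1 hexp
  refine ⟨-n, ?_⟩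
  have h := congrArg Complex.im hn
  have hI : -((∫ y in s..t, w y) / R ^ 2) = n * (2 * π) := by
    simpa [hθ, ← Complex.ofReal_pow, ← Complex.ofReal_div] using h
  field_simp at hI
  push_cast
  linarith

/-- A `C²` map of the closed unit disk whose boundary values lie on the circle of radius `R` about
the origin has signed area an integer multiple of `π R²`. -/
theorem exists_int_integral_area_form_closedBall {v : ℂ → ℂ} (hv : ContDiff ℝ 2 v) {R : ℝ}
    (hR : 0 < R) (hbdry : ∀ z ∈ Metric.sphere (0 : ℂ) 1, ‖v z‖ = R) :
    ∃ n : ℤ, ∫ z in Metric.closedBall (0 : ℂ) 1,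
      ((fderiv ℝ v z 1).re * (fderiv ℝ v z Complex.I).im -
        (fderiv ℝ v z 1).im * (fderiv ℝ v z Complex.I).re) = n * π * R ^ 2 := by
  set P : ℝ × ℝ → ℂ := fun p => p.1 * Complex.exp (p.2 * Complex.I) with hP
  have hPsymm : ∀ p, Complex.polarCoord.symm p = P p := fun p => by
    rw [Complex.polarCoord_symm_apply, hP]
    simp [Complex.exp_mul_I]
  have hPc : ContDiff ℝ 2 P :=
    (Complex.ofRealCLM.contDiff.comp contDiff_fst).mul
      ((Complex.ofRealCLM.contDiff.comp contDiff_snd).mul contDiff_const).cexp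
  have hP1 : ∀ p, HasFDerivAt P (fderiv ℝ P p) p := fun p =>
    (hPc.differentiable two_ne_zero p).hasFDerivAt
  have hPr : ∀ p, fderiv ℝ P p (1, 0) = Complex.exp (p.2 * Complex.I) := by
    intro p
    have h1 : HasDerivAt (fun x : ℝ => P (x, p.2)) (fderiv ℝ P p (1, 0)) p.1 :=
      (hP1 p).comp_hasDerivAt (f := fun x : ℝ => (x, p.2)) p.1
        ((hasDerivAt_id' p.1).prodMk (hasDerivAt_const p.1 p.2))
    have h2 : HasDerivAt (fun x : ℝ => P (x, p.2)) (((1 : ℝ) : ℂ) * Complex.exp (p.2 * Complex.I)) p.1 :=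
      (hasDerivAt_id' p.1).ofReal_comp.mul_const (Complex.exp (p.2 * Complex.I))
    rw [h1.unique h2, Complex.ofReal_one, one_mul]
  have hPθ : ∀ p, fderiv ℝ P p (0, 1) = p.1 * (Complex.exp (p.2 * Complex.I) * Complex.I) := by
    intro p
    have h1 : HasDerivAt (fun x : ℝ => P (p.1, x)) (fderiv ℝ P p (0, 1)) p.2 :=
      (hP1 p).comp_hasDerivAt (f := fun x : ℝ => (p.1, x)) p.2
        ((hasDerivAt_const p.2 p.1).prodMk (hasDerivAt_id' p.2))
    have h2 : HasDerivAt (fun x : ℝ => P (p.1, x))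
        (p.1 * (Complex.exp (p.2 * Complex.I) * (((1 : ℝ) : ℂ) * Complex.I))) p.2 :=
      (((hasDerivAt_id' p.2).ofReal_comp.mul_const Complex.I).cexp).const_mul (p.1 : ℂ)
    rw [h1.unique h2, Complex.ofReal_one, one_mul]
  have hW : ContDiff ℝ 2 (v ∘ P) := hv.comp hPc
  have hWd : ∀ p, fderiv ℝ (v ∘ P) p = (fderiv ℝ v (P p)).comp (fderiv ℝ P p) := fun p =>
    fderiv_comp p (hv.differentiable two_ne_zero _) (hPc.differentiable two_ne_zero p)
  set a : ℝ × ℝ → ℝ := fun p => (v (P p)).re with ha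
  set b : ℝ × ℝ → ℝ := fun p => (v (P p)).im with hb
  have hac : ContDiff ℝ 2 a := Complex.reCLM.contDiff.comp hW
  have hbc : ContDiff ℝ 2 b := Complex.imCLM.contDiff.comp hW
  have had : ∀ p w, fderiv ℝ a p w = (fderiv ℝ v (P p) (fderiv ℝ P p w)).re := fun p w => by
    have h := (Complex.reCLM.hasFDerivAt.comp p
      (hW.differentiable two_ne_zero p).hasFDerivAt).fderiv
    rw [hWd] at h
    exact DFunLike.congr_fun h w
  have hbd : ∀ p w, fderiv ℝ b p w = (fderiv ℝ v (P p) (fderiv ℝ P p w)).im := fun p w => by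
    have h := (Complex.imCLM.hasFDerivAt.comp p
      (hW.differentiable two_ne_zero p).hasFDerivAt).fderiv
    rw [hWd] at h
    exact DFunLike.congr_fun h w
  set J : ℂ → ℝ := fun z => (fderiv ℝ v z 1).re * (fderiv ℝ v z Complex.I).im -
    (fderiv ℝ v z 1).im * (fderiv ℝ v z Complex.I).re with hJ
  have hlin : ∀ (L : ℂ →L[ℝ] ℂ) (z : ℂ), L z = z.re * L 1 + z.im * L Complex.I := by
    intro L z
    conv_lhs => rw [show z = z.re • (1 : ℂ) + z.im • Complex.I by simp]
    rw [map_add, map_smul, map_smul]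
    simp
  have hjac : ∀ p, fderiv ℝ a p (1, 0) * fderiv ℝ b p (0, 1) -
      fderiv ℝ b p (1, 0) * fderiv ℝ a p (0, 1) = p.1 * J (P p) := by
    intro p
    rw [had, had, hbd, hbd, hPr, hPθ, hlin _ (Complex.exp _), hlin _ (_ * _)]
    simp only [hJ, Complex.exp_ofReal_mul_I_re, Complex.exp_ofReal_mul_I_im, Complex.add_re,
      Complex.add_im, Complex.mul_re, Complex.mul_im, Complex.ofReal_re, Complex.ofReal_im,
      Complex.I_re, Complex.I_im]
    linear_combination p.1 * ((fderiv ℝ v (P p) 1).re * (fderiv ℝ v (P p) Complex.I).im -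
      (fderiv ℝ v (P p) 1).im * (fderiv ℝ v (P p) Complex.I).re) * Real.sin_sq_add_cos_sq p.2
  have hpolar : ∫ z in Metric.closedBall (0 : ℂ) 1, J z =
      ∫ p in Icc ((0 : ℝ), -π) (1, π), p.1 * J (P p) := by
    rw [← integral_indicator Metric.isClosed_closedBall.measurableSet,
      ← Complex.integral_comp_polarCoord_symm, polarCoord_target]
    have hset : (Icc ((0 : ℝ), -π) (1, π) : Set (ℝ × ℝ)) =ᵐ[volume]
        (Ioc (0 : ℝ) 1 ×ˢ Ioo (-π) π : Set (ℝ × ℝ)) := by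
      rw [Icc_prod_eq]
      exact Measure.set_prod_ae_eq Ioc_ae_eq_Icc.symm Ioo_ae_eq_Icc.symm
    rw [setIntegral_congr_set hset,
      ← integral_indicator (measurableSet_Ioi.prod measurableSet_Ioo),
      ← integral_indicator (measurableSet_Ioc.prod measurableSet_Ioo)]
    refine integral_congr_ae (Filter.Eventually.of_forall fun p => ?_)
    have hmem : P p ∈ Metric.closedBall (0 : ℂ) 1 ↔ |p.1| ≤ 1 := by
      simp [hP, Complex.norm_exp_ofReal_mul_I]
    simp only [hPsymm, indicator, hmem, mem_prod, mem_Ioi, mem_Ioc, smul_eq_mul]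
    by_cases h0 : 0 < p.1
    · by_cases h1 : p.1 ≤ 1 <;> simp [h0, h1, abs_of_pos]
    · simp [h0]
  have hper : ∀ x : ℝ, P (x, -π) = P (x, π) := fun x => by
    simp [hP, Complex.exp_neg, Complex.exp_pi_mul_I]
  have hgreen := integral_jacobian_Icc_eq_boundary hac hbc
    (show ((0 : ℝ), -π) ≤ (1, π) from ⟨zero_le_one, by simpa using Real.pi_pos.le⟩)
  simp only [hjac] at hgreen
  obtain ⟨n, hn⟩ := exists_int_integral_area_form_of_norm_eq (γ := fun x => v (P (1, x)))
    (γ' := fun x => fderiv ℝ (v ∘ P) (1, x) (0, 1)) (s := -π) (t := π) hR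
    (fun x => ((hW.differentiable two_ne_zero (1, x)).hasFDerivAt).comp_hasDerivAt x
      ((hasDerivAt_const x 1).prodMk (hasDerivAt_id x)))
    (((hW.continuous_fderiv two_ne_zero).comp (by fun_prop)).clm_apply continuous_const)
    (fun x => hbdry _ (by simp [hP, Complex.norm_exp_ofReal_mul_I])) (by rw [hper])
  refine ⟨n, ?_⟩
  rw [hpolar, hgreen]
  have hzero : ∀ y : ℝ, fderiv ℝ P (0, y) (0, 1) = 0 := fun y => by rw [hPθ]; simp
  have hside : ∀ x : ℝ, fderiv ℝ P (x, -π) (1, 0) = fderiv ℝ P (x, π) (1, 0) := fun x => by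
    rw [hPr, hPr]; simp [Complex.exp_neg, Complex.exp_pi_mul_I]
  have haper : ∀ x : ℝ, a (x, -π) = a (x, π) := fun x => by simp only [ha, hper]
  have hbper : ∀ x : ℝ, b (x, -π) = b (x, π) := fun x => by simp only [hb, hper]
  simp only [had, hbd, hzero, hside, haper, hbper, hper, map_zero, Complex.zero_re, Complex.zero_im,
    mul_zero, sub_zero, zero_div, intervalIntegral.integral_zero, sub_self, zero_add]
  rw [intervalIntegral.integral_div]
  simp only [hWd, ContinuousLinearMap.comp_apply] at hn
  rw [hn]
  ring

/-- **Disk areas on a product torus are integer combinations of `π rᵢ²`.**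
Every smooth disk in `ℂ^N` with boundary on the product torus of radii `r i` has
symplectic area `∑ i, nᵢ · π rᵢ²` for some integers `nᵢ` (the winding numbers of its
boundary loop). -/
theorem sympArea_disk_on_product_torus_eq_int_combination
    (N : ℕ) (hN : 1 ≤ N) (r : Fin N → ℝ) (hr : ∀ i, 0 < r i)
    (u : ℂ → (Fin N → ℂ)) (hu : ContDiff ℝ (⊤ : ℕ∞) u)
    (hbdry : u '' Metric.sphere (0:ℂ) 1 ⊆ {z : Fin N → ℂ | ∀ i, ‖z i‖ = r i}) :
    ∃ n : Fin N → ℤ, sympArea u = ∑ i, (n i : ℝ) * π * (r i) ^ 2 := by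
  have hu2 : ContDiff ℝ 2 u := contDiff_infty.1 hu 2
  have hui : ∀ i, ContDiff ℝ 2 fun z => u z i := contDiff_pi.1 hu2
  choose n hn using fun i => exists_int_integral_area_form_closedBall (hui i) (hr i)
    fun z hz => hbdry ⟨z, hz, rfl⟩ i
  refine ⟨n, ?_⟩
  have hcomp : ∀ z w i, fderiv ℝ u z w i = fderiv ℝ (fun z => u z i) z w := fun z w i => by
    rw [fderiv_pi fun i => (hui i).differentiable two_ne_zero z]
    rfl
  have hc : ∀ i w, Continuous fun z => fderiv ℝ (fun z => u z i) z w := fun i w =>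
    ((hui i).continuous_fderiv two_ne_zero).clm_apply continuous_const
  simp only [sympArea, stdOmega, hcomp]
  rw [integral_finsetSum]
  · exact Finset.sum_congr rfl fun i _ => hn i
  · intro i _
    exact (((Complex.continuous_re.comp (hc i 1)).mul (Complex.continuous_im.comp
      (hc i Complex.I))).sub ((Complex.continuous_im.comp (hc i 1)).mul (Complex.continuous_re.comp
      (hc i Complex.I)))).continuousOn.integrableOn_compact (isCompact_closedBall 0 1)

end
end

section
/- Let a b : ℝ with 0 < a and 0 < b, and let g g' : ℝ → ℝ satisfy: HasDerivAt g (g' x) x for every x ∈ Set.Icc 0 a; g 0 = b; g a = 0; g' 0 < 0; and g' strictly antitone on Set.Icc 0 a. Let Ω := {v : ℝ × ℝ | 0 ≤ v.1 ∧ v.1 ≤ a ∧ 0 ≤ v.2 ∧ v.2 ≤ g v.1}. Let x₀ satisfy 0 < x₀ < a, and suppose there are natural numbers l, m ≥ 1 and a real c > 0 with -(g' x₀) = c * l and 1 = c * m (the outward normal at w := (x₀, g x₀) is parallel to (l, m)). Set r₁ := Real.sqrt (x₀ / π), r₂ := Real.sqrt (g x₀ / π), and γ₁ t := (r₁ : ℂ)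 * Complex.exp (2 * π * l * t * Complex.I), γ₂ t := (r₂ : ℂ) * Complex.exp (2 * π * m * t * Complex.I). Then the action ∫ t in (0:ℝ)..1, (1/2) * (((starRingEnd ℂ) (γ₁ t) * deriv γ₁ t).im + ((starRingEnd ℂ) (γ₂ t) * deriv γ₂ t).im) is the greatest element of the set {y : ℝ | ∃ v ∈ Ω, y = l * v.1 + m * v.2} (IsGreatest); that is, the action of the closed Reeb orbit on the torus fiber μ⁻¹(w) equals max over v ∈ Ω of ⟨v, (l, m)⟩. -/
open scoped Real

/-- A function with antitone derivative on a convex set lies below its tangent line at any of its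
points. -/
theorem le_tangent_of_antitoneOn_deriv {s : Set ℝ} (hs : Convex ℝ s) {f f' : ℝ → ℝ}
    (hf : ∀ x ∈ s, HasDerivAt f (f' x) x) (hf' : AntitoneOn f' s)
    {x₀ x : ℝ} (hx₀ : x₀ ∈ s) (hx : x ∈ s) :
    f x ≤ f x₀ + f' x₀ * (x - x₀) := by
  have hderiv (y : ℝ) (hy : y ∈ s) :
      HasDerivAt (fun z ↦ f z - f' x₀ * z) (f' y - f' x₀) y := by
    simpa using (hf y hy).fun_sub ((hasDerivAt_id y).const_mul (f' x₀))
  have hconc : ConcaveOn ℝ s (fun z ↦ f z - f' x₀ * z) := by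
    refine AntitoneOn.concaveOn_of_deriv hs
      (fun y hy ↦ (hderiv y hy).continuousAt.continuousWithinAt)
      (fun y hy ↦ (hderiv y (interior_subset hy)).differentiableAt.differentiableWithinAt) ?_
    intro y hy z hz hyz
    rw [(hderiv y (interior_subset hy)).deriv, (hderiv z (interior_subset hz)).deriv]
    exact sub_le_sub_right (hf' (interior_subset hy) (interior_subset hz) hyz) _
  have hcrit : HasDerivAt (fun z ↦ f z - f' x₀ * z) 0 x₀ := by
    simpa using hderiv x₀ hx₀
  rcases lt_trichotomy x x₀ with h | rfl | h
  · have := hconc.le_slope_of_hasDerivAt hx hx₀ h hcrit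
    rw [slope_def_field, le_div_iff₀ (sub_pos.2 h)] at this
    linarith
  · simp
  · have := hconc.slope_le_of_hasDerivAt hx₀ hx h hcrit
    rw [slope_def_field, div_le_iff₀ (sub_pos.2 h)] at this
    linarith

/-- The pullback of `xdy - ydx` along the circle of area `A` traversed `n` times per unit time. -/
theorem im_conj_mul_deriv_circle {A : ℝ} (hA : 0 ≤ A) (n : ℕ) {γ : ℝ → ℂ}
    (hγ : ∀ t : ℝ, γ t = (Real.sqrt (A / π) : ℂ) *
      Complex.exp (2 * (π : ℂ) * (n : ℂ) * (t : ℂ) * Complex.I)) (t : ℝ) :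
    ((starRingEnd ℂ) (γ t) * deriv γ t).im = 2 * (n * A) := by
  have hd : HasDerivAt γ (γ t * (2 * (π : ℂ) * (n : ℂ) * Complex.I)) t := by
    have h := (((Complex.ofRealCLM.hasDerivAt (x := t)).const_mul
      (2 * (π : ℂ) * (n : ℂ))).mul_const Complex.I).cexp.const_mul (Real.sqrt (A / π) : ℂ)
    rw [funext hγ]
    simpa [mul_assoc] using h
  have hnorm : Complex.normSq (γ t) = A / π := by
    have he : 2 * (π : ℂ) * (n : ℂ) * (t : ℂ) * Complex.I =
        ((2 * π * n * t : ℝ) : ℂ) * Complex.I := by push_cast; ring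
    rw [hγ, he, Complex.normSq_eq_norm_sq, norm_mul, Complex.norm_exp_ofReal_mul_I, mul_one,
      Complex.norm_real, Real.norm_eq_abs, sq_abs, Real.sq_sqrt (by positivity)]
  have hc : 2 * (π : ℂ) * (n : ℂ) * Complex.I = ((2 * π * n : ℝ) : ℂ) * Complex.I := by
    push_cast; ring
  rw [hd.deriv, ← mul_assoc, ← Complex.normSq_eq_conj_mul_self, hnorm, hc, ← mul_assoc,
    ← Complex.ofReal_mul, Complex.im_ofReal_mul, Complex.I_im]
  field_simp

/-- **(Proposition 4.8.)** If the outward normal of the moment region `Ω` at the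
boundary point `w = (x₀, g x₀)` (with `0 < x₀ < a`) is parallel to `(l, m)` with
`l, m ≥ 1`, then the action of the closed Reeb orbit with winding numbers `(l, m)`
on the torus fiber `μ⁻¹(w)` equals `max_{v ∈ Ω} ⟨v, (l, m)⟩`. -/
theorem action_of_reeb_orbit_is_max_of_support_function
    (a b : ℝ) (ha : 0 < a) (hb : 0 < b) (g g' : ℝ → ℝ)
    (hderiv : ∀ x ∈ Set.Icc (0:ℝ) a, HasDerivAt g (g' x) x)
    (hg0 : g 0 = b) (hga : g a = 0) (hg'0 : g' 0 < 0)
    (hanti : StrictAntiOn g' (Set.Icc (0:ℝ) a))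
    (x₀ : ℝ) (hx₀pos : 0 < x₀) (hx₀a : x₀ < a)
    (l m : ℕ) (hl : 1 ≤ l) (hm : 1 ≤ m) (c : ℝ) (hc : 0 < c)
    (hnorm₁ : -(g' x₀) = c * l) (hnorm₂ : (1 : ℝ) = c * m)
    (r₁ r₂ : ℝ) (hr₁ : r₁ = Real.sqrt (x₀ / π)) (hr₂ : r₂ = Real.sqrt (g x₀ / π))
    (γ₁ γ₂ : ℝ → ℂ)
    (hγ₁ : ∀ t : ℝ, γ₁ t = (r₁ : ℂ) * Complex.exp (2 * (π : ℂ) * (l : ℂ) * (t : ℂ) * Complex.I))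
    (hγ₂ : ∀ t : ℝ, γ₂ t = (r₂ : ℂ) * Complex.exp (2 * (π : ℂ) * (m : ℂ) * (t : ℂ) * Complex.I)) :
    IsGreatest
      {y : ℝ | ∃ v ∈ {v : ℝ × ℝ | 0 ≤ v.1 ∧ v.1 ≤ a ∧ 0 ≤ v.2 ∧ v.2 ≤ g v.1},
        y = (l : ℝ) * v.1 + (m : ℝ) * v.2}
      (∫ t in (0:ℝ)..1,
        (1 / 2 : ℝ) * (((starRingEnd ℂ) (γ₁ t) * deriv γ₁ t).im +
          ((starRingEnd ℂ) (γ₂ t) * deriv γ₂ t).im)) := by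
  have htangent (x : ℝ) (hx : x ∈ Set.Icc 0 a) : g x ≤ g x₀ + g' x₀ * (x - x₀) :=
    le_tangent_of_antitoneOn_deriv (convex_Icc 0 a) hderiv hanti.antitoneOn
      ⟨hx₀pos.le, hx₀a.le⟩ hx
  have hslope : g' x₀ = -(c * l) := by linarith
  have hgx₀ : 0 ≤ g x₀ := by
    have h := htangent a ⟨ha.le, le_rfl⟩
    have : 0 ≤ c * l * (a - x₀) := mul_nonneg (by positivity) (sub_nonneg.2 hx₀a.le)
    rw [hga, hslope] at h
    linarith
  subst hr₁ hr₂
  have haction : (∫ t in (0:ℝ)..1,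
      (1 / 2 : ℝ) * (((starRingEnd ℂ) (γ₁ t) * deriv γ₁ t).im +
        ((starRingEnd ℂ) (γ₂ t) * deriv γ₂ t).im)) = l * x₀ + m * g x₀ := by
    simp only [im_conj_mul_deriv_circle hx₀pos.le l hγ₁, im_conj_mul_deriv_circle hgx₀ m hγ₂,
      intervalIntegral.integral_const, sub_zero, one_smul]
    ring
  rw [haction]
  refine ⟨⟨(x₀, g x₀), ⟨hx₀pos.le, hx₀a.le, hgx₀, le_rfl⟩, rfl⟩, ?_⟩
  rintro _ ⟨⟨x, y⟩, ⟨hx0, hxa, -, hy⟩, rfl⟩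
  calc (l : ℝ) * x + m * y
      ≤ l * x + m * (g x₀ + g' x₀ * (x - x₀)) := by
        gcongr
        exact hy.trans (htangent x ⟨hx0, hxa⟩)
    _ = l * x₀ + m * g x₀ := by
        rw [hslope]
        linear_combination (l * (x - x₀)) * hnorm₂
end

section
/- Let p q : ℕ with 0 < p and 0 < q, and let a b : ℝ with 0 < a, 0 < b and (q : ℝ) * b = (p : ℝ) * a (i.e. b/a = p/q). Then, with k := p + q, the number (k : ℝ) * (a * b / (a + b)) is the least element (IsLeast) of the set {x : ℝ | ∃ l m : ℕ, l + m = k ∧ x = max ((l:ℝ) * a) ((m:ℝ) * b)}. In particular, for every rational ellipsoid E(a,b) there exists a positive integer k with c_k^GH(E(a,b)) = k · diagonal(E(a,b)) = k·ab/(a+b). -/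
/-- The maximum of `l a` and `m b` is at least `l + m` times the diagonal of `E(a,b)`. -/
theorem add_mul_harmonic_le_max (l m : ℕ) {a b : ℝ} (ha : 0 < a) (hb : 0 < b) :
    ((l + m : ℕ) : ℝ) * (a * b / (a + b)) ≤ max ((l : ℝ) * a) ((m : ℝ) * b) := by
  rw [← mul_div_assoc, div_le_iff₀ (add_pos ha hb)]
  push_cast
  have hl := mul_le_mul_of_nonneg_right (le_max_left ((l : ℝ) * a) ((m : ℝ) * b)) hb.le
  have hm := mul_le_mul_of_nonneg_right (le_max_right ((l : ℝ) * a) ((m : ℝ) * b)) ha.le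
  linarith

/-- **For a rational ellipsoid `E(a,b)` there is `k` with
`c_k^GH(E(a,b)) = k · diagonal(E(a,b))`.** If `b/a = p/q` with `p, q ≥ 1`, then with
`k = p + q` the number `k·ab/(a+b)` is the least element of
`{max (l a) (m b) | l + m = k}`. -/
theorem rational_ellipsoid_capacity_eq_mul_diagonal
    (p q : ℕ) (hp : 0 < p) (hq : 0 < q)
    (a b : ℝ) (ha : 0 < a) (hb : 0 < b) (hab : (q : ℝ) * b = (p : ℝ) * a) :
    IsLeast
      {x : ℝ | ∃ l m : ℕ, l + m = p + q ∧ x = max ((l : ℝ) * a) ((m : ℝ) * b)}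
      ((p + q : ℕ) * (a * b / (a + b))) := by
  have hmin : ((p + q : ℕ) : ℝ) * (a * b / (a + b)) = p * a := by
    push_cast
    field_simp
    linear_combination hab
  refine ⟨⟨p, q, rfl, by rw [hmin, hab, max_self]⟩, ?_⟩
  rintro x ⟨l, m, hlm, rfl⟩
  rw [← hlm]
  exact add_mul_harmonic_le_max l m ha hb
end
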